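/- Let F be a number field with ring of integers O_F, and let n be a composite positive integer (n > 1 and n not prime). Then there exists a polynomial f(x) ∈ F[x] of degree n that is irreducible over F but is reducible over the completion F_v of F at v for every nonzero prime ideal v of O_F. -/

import Mathlib

section

open IsDedekindDomain HeightOneSpectrum Polynomial

namespace IsDedekindDomain.HeightOneSpectrum

variable {R : Type*} [CommRing R] [IsDedekindDomain R] (K : Type*) [Field K] [Algebra R K]
  [IsFractionRing R K] (v : HeightOneSpectrum R)

theorem adicCompletionIntegers_mem_maximalIdeal_iff {x : v.adicCompletionIntegers K} :
    x ∈ IsLocalRing.maximalIdeal (v.adicCompletionIntegers K) ↔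
      Valued.v (x : v.adicCompletion K) < 1 := by
  rw [IsLocalRing.mem_maximalIdeal, mem_nonunits_iff,
    adicCompletionIntegers.isUnit_iff_valued_eq_one, lt_iff_le_and_ne]
  exact ⟨fun h => ⟨x.2, h⟩, fun h => h.2⟩

theorem algebraMap_mem_maximalIdeal_iff (r : R) :
    algebraMap R (v.adicCompletionIntegers K) r ∈
      IsLocalRing.maximalIdeal (v.adicCompletionIntegers K) ↔ r ∈ v.asIdeal := by
  rw [adicCompletionIntegers_mem_maximalIdeal_iff, ← v.valuation_lt_one_iff_mem (K := K),
    ← valuedAdicCompletion_eq_valuation]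
  rfl

theorem exists_maximalIdeal_pow_eq_span :
    ∃ ϖ : v.adicCompletionIntegers K, ϖ ≠ 0 ∧ Valued.v (ϖ : v.adicCompletion K) < 1 ∧
      ∀ n (x : v.adicCompletionIntegers K),
        x ∈ IsLocalRing.maximalIdeal (v.adicCompletionIntegers K) ^ n ↔
          Valued.v (x : v.adicCompletion K) ≤ Valued.v (ϖ : v.adicCompletion K) ^ n := by
  obtain ⟨ϖ, hϖ⟩ := IsDiscreteValuationRing.exists_irreducible (v.adicCompletionIntegers K)
  refine ⟨ϖ, hϖ.ne_zero, ?_, fun n x => ?_⟩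
  · rw [← adicCompletionIntegers_mem_maximalIdeal_iff]
    exact hϖ.not_isUnit
  · rw [hϖ.maximalIdeal_eq, Ideal.span_singleton_pow, Ideal.mem_span_singleton,
      (adicCompletionIntegers.integers K v).dvd_iff_le, map_pow, map_pow]
    rfl

theorem exists_algebraMap_sub_mem (x : v.adicCompletionIntegers K) :
    ∃ r : R, x - algebraMap R (v.adicCompletionIntegers K) r ∈
      IsLocalRing.maximalIdeal (v.adicCompletionIntegers K) := by
  obtain ⟨k, hk⟩ : ∃ k : K, Valued.v ((x : v.adicCompletion K) - algebraMap K _ k) < 1 := by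
    have hU : {y : v.adicCompletion K | Valued.v ((x : v.adicCompletion K) - y) < 1} ∈
        nhds (x : v.adicCompletion K) := by
      refine Valued.mem_nhds.mpr ⟨1, fun y hy => ?_⟩
      rw [Set.mem_ofPred_eq, Units.val_one, ← map_one (Valued.v.restrict),
        Valuation.restrict_lt_iff, map_one] at hy
      rwa [Set.mem_ofPred_eq, Valuation.map_sub_swap]
    obtain ⟨_, hy, ⟨k, rfl⟩⟩ := (mem_closure_iff_nhds.mp
      (denseRange_algebraMap K v (x : v.adicCompletion K))) _ hU
    exact ⟨k, hy⟩
  have hk1 : v.valuation K k ≤ 1 := by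
    rw [← valuedAdicCompletion_eq_valuation']
    have := Valued.v.map_sub (x : v.adicCompletion K) (x - algebraMap K _ k)
    rw [sub_sub_cancel] at this
    exact this.trans (max_le x.2 hk.le)
  obtain ⟨r, hr⟩ := exists_valuation_sub_lt_of_integer v hk1 1
  refine ⟨r, (adicCompletionIntegers_mem_maximalIdeal_iff K v).mpr ?_⟩
  rw [← valuedAdicCompletion_eq_valuation', Units.val_one] at hr
  have h : ((x - algebraMap R (v.adicCompletionIntegers K) r : v.adicCompletionIntegers K) :
      v.adicCompletion K) = (x - algebraMap K _ k) -
        ((algebraMap R K r - k : K) : v.adicCompletion K) := by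
    change (x : v.adicCompletion K) - algebraMap K _ (algebraMap R K r) =
      (x - algebraMap K _ k) - algebraMap K _ (algebraMap R K r - k)
    rw [map_sub]
    ring
  rw [h]
  exact (Valued.v.map_sub _ _).trans_lt (max_lt hk hr)

theorem adicCompletionIntegers_isAdicComplete :
    IsAdicComplete (IsLocalRing.maximalIdeal (v.adicCompletionIntegers K))
      (v.adicCompletionIntegers K) where
  prec' f hf := by
    obtain ⟨ϖ, hϖ0, hϖ1, hϖ⟩ := exists_maximalIdeal_pow_eq_span K v
    have hv0 (n : ℕ) :
        Valued.v ((ϖ ^ n : v.adicCompletionIntegers K) : v.adicCompletion K) ≠ 0 := by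
      simpa using fun h : ϖ = 0 => absurd h hϖ0
    simp only [smul_eq_mul, Ideal.mul_top, SModEq.sub_mem, hϖ] at hf ⊢
    have hcauchy : CauchySeq fun n => (f n : v.adicCompletion K) := by
      rw [CauchySeq, Valued.cauchy_iff]
      refine ⟨inferInstance, fun γ => ?_⟩
      obtain ⟨N, hN⟩ := exists_pow_lt₀ hϖ1
        (Units.mk0 (MonoidWithZeroHom.ValueGroup₀.embedding γ.1) (by simp))
      refine ⟨_, Filter.image_mem_map (Filter.Ici_mem_atTop N), ?_⟩
      rintro _ ⟨m, hm, rfl⟩ _ ⟨n, hn, rfl⟩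
      rw [Valuation.restrict_lt_iff_lt_embedding]
      have := Valued.v.map_sub ((f N : v.adicCompletion K) - f m) (f N - f n)
      rw [sub_sub_sub_cancel_left] at this
      exact (this.trans (max_le (hf hm) (hf hn))).trans_lt hN
    obtain ⟨L, hL⟩ := cauchySeq_tendsto_of_complete hcauchy
    have key (n : ℕ) : Valued.v ((f n : v.adicCompletion K) - L) ≤
        Valued.v (ϖ : v.adicCompletion K) ^ n := by
      have hU : {y : v.adicCompletion K | Valued.v (L - y) <
          Valued.v ((ϖ ^ n : v.adicCompletionIntegers K) : v.adicCompletion K)} ∈ nhds L := by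
        refine Valued.mem_nhds.mpr ⟨Units.mk0 (Valued.v.restrict
          ((ϖ ^ n : v.adicCompletionIntegers K) : v.adicCompletion K)) ?_, fun y hy => ?_⟩
        · simpa using hv0 n
        · rw [Set.mem_ofPred_eq, Units.val_mk0, Valuation.restrict_lt_iff] at hy
          rwa [Set.mem_ofPred_eq, Valuation.map_sub_swap]
      obtain ⟨m, hm, hnm⟩ := ((hL.eventually hU).and (Filter.eventually_ge_atTop n)).exists
      have := Valued.v.map_sub ((f n : v.adicCompletion K) - f m) (L - f m)
      rw [sub_sub_sub_cancel_right] at this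
      refine this.trans (max_le (hf hnm) ?_)
      simpa using hm.le
    refine ⟨⟨L, ?_⟩, key⟩
    have := Valued.v.map_sub (f 0 : v.adicCompletion K) ((f 0 : v.adicCompletion K) - L)
    rw [sub_sub_cancel] at this
    exact this.trans (max_le (f 0).2 (by simpa using key 0))

theorem finite_residueField_adicCompletionIntegers [Finite (R ⧸ v.asIdeal)] :
    Finite (IsLocalRing.ResidueField (v.adicCompletionIntegers K)) := by
  refine Finite.of_surjective (Ideal.Quotient.lift v.asIdeal
    ((IsLocalRing.residue _).comp (algebraMap R (v.adicCompletionIntegers K))) fun r hr => ?_) ?_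
  · rwa [RingHom.comp_apply, IsLocalRing.residue_eq_zero_iff, algebraMap_mem_maximalIdeal_iff]
  · intro x
    obtain ⟨x, rfl⟩ := IsLocalRing.residue_surjective x
    obtain ⟨r, hr⟩ := exists_algebraMap_sub_mem K v x
    refine ⟨Ideal.Quotient.mk _ r, ?_⟩
    rw [Ideal.Quotient.lift_mk, RingHom.comp_apply, eq_comm, ← sub_eq_zero, ← map_sub,
      IsLocalRing.residue_eq_zero_iff]
    exact hr

end IsDedekindDomain.HeightOneSpectrum

theorem IsAdicComplete.of_finite_module {O M : Type*} [CommRing O] [IsNoetherianRing O]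
    [IsLocalRing O] [IsAdicComplete (IsLocalRing.maximalIdeal O) O] [AddCommGroup M] [Module O M]
    [Module.Finite O M] : IsAdicComplete (IsLocalRing.maximalIdeal O) M where
  toIsPrecomplete := by
    rw [← AdicCompletion.of_surjective_iff]
    intro x
    obtain ⟨z, rfl⟩ :=
      AdicCompletion.ofTensorProduct_surjective_of_finite (IsLocalRing.maximalIdeal O) M x
    induction z using TensorProduct.induction_on with
    | zero => exact ⟨0, by simp⟩
    | tmul r x =>
      obtain ⟨r, rfl⟩ := AdicCompletion.of_surjective (IsLocalRing.maximalIdeal O) O r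
      refine ⟨r • x, ?_⟩
      rw [AdicCompletion.ofTensorProduct_tmul]
      ext n
      rw [map_smul]
      rfl
    | add x y hx hy =>
      obtain ⟨a, ha⟩ := hx
      obtain ⟨b, hb⟩ := hy
      exact ⟨a + b, by rw [map_add, map_add, ha, hb]⟩

theorem HenselianRing.of_finite_algebra {O A : Type*} [CommRing O] [IsNoetherianRing O]
    [IsLocalRing O] [IsAdicComplete (IsLocalRing.maximalIdeal O) O] [CommRing A] [Algebra O A]
    [Module.Finite O A] :
    HenselianRing A ((IsLocalRing.maximalIdeal O).map (algebraMap O A)) := by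
  have := IsAdicComplete.of_finite_module (O := O) (M := A)
  have : IsAdicComplete ((IsLocalRing.maximalIdeal O).map (algebraMap O A)) A :=
    { toIsHausdorff := IsHausdorff.map_algebraMap_iff.mpr inferInstance
      toIsPrecomplete := IsPrecomplete.map_algebraMap_iff.mpr inferInstance }
  infer_instance

theorem ZMod.natCast_pow_ne_one {p Q m : ℕ} (hp : p.Prime) (hm0 : m ≠ 0)
    (hm : ∀ q : ℕ, q.Prime → q ∣ m → p ≤ q) (hQ : (Q : ZMod p) ≠ 1) : (Q : ZMod p) ^ m ≠ 1 := by
  have := Fact.mk hp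
  intro h
  have hQ0 : (Q : ZMod p) ≠ 0 := by
    intro h0
    simp [h0, hm0] at h
  have h1 : orderOf (Q : ZMod p) ∣ m := orderOf_dvd_of_pow_eq_one h
  have h2 : orderOf (Q : ZMod p) ∣ p - 1 :=
    orderOf_dvd_of_pow_eq_one (ZMod.pow_card_sub_one_eq_one hQ0)
  obtain ⟨q, hq, hqd⟩ := Nat.exists_prime_and_dvd (n := orderOf (Q : ZMod p)) (by
    rwa [Ne, orderOf_eq_one_iff])
  have h3 := hm q hq (hqd.trans h1)
  have h4 := Nat.le_of_dvd (Nat.sub_pos_of_lt hp.one_lt) (hqd.trans h2)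
  have := hp.one_lt
  omega

theorem FiniteField.exists_pow_eq_pow_mul_norm_pow {k S : Type*} [Field k] [Field S] [Finite S]
    [Algebra k S] {p : ℕ} (hp : p.Prime)
    (hm : ∀ q : ℕ, q.Prime → q ∣ Module.finrank k S → p ≤ q) (u : S) :
    ∃ δ : S, δ ^ p = u ^ Module.finrank k S * algebraMap k S (Algebra.norm k u) ^ (p - 1) := by
  have := Fact.mk hp
  have hfin : Finite k := Finite.of_injective _ (algebraMap k S).injective
  have hfd : FiniteDimensional k S := Module.Finite.of_finite
  set m := Module.finrank k S with hmdef
  have hm0 : m ≠ 0 := Module.finrank_pos.ne'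
  by_cases hQ : (Nat.card k : ZMod p) = 1
  · rw [FiniteField.algebraMap_norm_eq_pow_sum, ← pow_mul, ← pow_add, ← hmdef]
    have hdvd : p ∣ m + (∑ i ∈ Finset.range m, Nat.card k ^ i) * (p - 1) := by
      rw [← CharP.cast_eq_zero_iff (ZMod p) p]
      push_cast [Nat.cast_sub hp.one_le]
      simp [hQ]
    obtain ⟨j, hj⟩ := hdvd
    exact ⟨u ^ j, by rw [hj, ← pow_mul, mul_comm p]⟩
  · by_cases hw : u ^ m * algebraMap k S (Algebra.norm k u) ^ (p - 1) = 0
    · exact ⟨0, by rw [hw, zero_pow hp.ne_zero]⟩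
    · have hco : (Nat.card Sˣ).Coprime p := by
        rw [Nat.coprime_comm, hp.coprime_iff_not_dvd, Nat.card_units,
          ← CharP.cast_eq_zero_iff (ZMod p) p, Nat.cast_sub Nat.card_pos, sub_eq_zero,
          Module.natCard_eq_pow_finrank (K := k), Nat.cast_pow, Nat.cast_one]
        exact ZMod.natCast_pow_ne_one hp hm0 hm hQ
      obtain ⟨δ, hδ⟩ := (powCoprime hco).surjective (Units.mk0 _ hw)
      exact ⟨δ, by simpa using congrArg Units.val hδ⟩

theorem AdjoinRoot.norm_algebraMap_sub_root {k : Type*} [Field k] {f : k[X]} (hf : f.Monic)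
    (z : k) : Algebra.norm k (algebraMap k (AdjoinRoot f) z - AdjoinRoot.root f) = f.eval z := by
  have := hf.finite_adjoinRoot
  rw [Algebra.norm_apply, map_sub, AlgHom.commutes, ← LinearMap.eval_charpoly]
  congr 1
  rw [← LinearMap.charpoly_toMatrix _ (AdjoinRoot.powerBasis' hf).basis]
  have h := charpoly_leftMulMatrix (AdjoinRoot.powerBasis' hf)
  rw [AdjoinRoot.powerBasis'_gen, AdjoinRoot.minpoly_root hf.ne_zero, hf.leadingCoeff, inv_one,
    map_one, mul_one] at h
  exact h

theorem AdjoinRoot.norm_one_sub_mul_root {k : Type*} [Field k] {f : k[X]} (hf : f.Monic) (y : k) :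
    Algebra.norm k (1 - algebraMap k (AdjoinRoot f) y * AdjoinRoot.root f) = f.reverse.eval y := by
  by_cases hy : y = 0
  · rw [hy, map_zero, zero_mul, sub_zero, map_one, ← coeff_zero_eq_eval_zero, coeff_zero_reverse,
      hf]
  · have h1 : (1 - algebraMap k (AdjoinRoot f) y * AdjoinRoot.root f) =
        algebraMap k (AdjoinRoot f) y * (algebraMap k _ y⁻¹ - AdjoinRoot.root f) := by
      rw [mul_sub, ← map_mul, mul_inv_cancel₀ hy, map_one]
    have hfr : Module.finrank k (AdjoinRoot f) = f.natDegree :=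
      (AdjoinRoot.powerBasis' hf).finrank
    have hinv : Invertible y⁻¹ := invertibleOfNonzero (inv_ne_zero hy)
    have h2 := eval₂_reverse_mul_pow (RingHom.id k) y⁻¹ f
    rw [invOf_eq_inv, inv_inv] at h2
    rw [h1, map_mul, Algebra.norm_algebraMap, AdjoinRoot.norm_algebraMap_sub_root hf, hfr]
    simp only [eval₂_id] at h2
    rw [← h2, inv_pow]
    field_simp

theorem HenselianRing.exists_isRoot {A S : Type*} [CommRing A] [CommRing S] (φ : A →+* S)
    (hφ : Function.Surjective φ) [HenselianRing A (RingHom.ker φ)] {q : A[X]} (hq : q.Monic) {s : S}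
    (hs : q.eval₂ φ s = 0) (hs' : IsUnit (q.derivative.eval₂ φ s)) :
    ∃ a, q.IsRoot a ∧ φ a = s := by
  obtain ⟨a₀, rfl⟩ := hφ s
  rw [eval₂_at_apply] at hs hs'
  obtain ⟨a, ha, haa⟩ := HenselianRing.is_henselian (I := RingHom.ker φ) q hq a₀ hs (by
    rw [← RingHom.quotientKerEquivOfSurjective_apply_mk hφ] at hs'
    exact (MulEquiv.isUnit_map _).mp hs')
  exact ⟨a, ha, by rwa [RingHom.mem_ker, map_sub, sub_eq_zero] at haa⟩

namespace AdjoinRoot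

variable {O k : Type*} [CommRing O] [CommRing k] (φ : O →+* k)

theorem map_mk (f P : O[X]) :
    AdjoinRoot.map φ f (f.map φ) dvd_rfl (mk f P) = mk (f.map φ) (P.map φ) := by
  simp only [AdjoinRoot.map, lift_mk]
  rw [← eval₂_map, ← algebraMap_eq, ← aeval_def, aeval_eq]

theorem map_surjective (hφ : Function.Surjective φ) (f : O[X]) :
    Function.Surjective (AdjoinRoot.map φ f (f.map φ) dvd_rfl) := fun s ↦ by
  obtain ⟨P, rfl⟩ := mk_surjective s
  obtain ⟨Q, rfl⟩ := Polynomial.map_surjective φ hφ P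
  exact ⟨mk f Q, map_mk φ f Q⟩

theorem ker_map (hφ : Function.Surjective φ) (f : O[X]) :
    RingHom.ker (AdjoinRoot.map φ f (f.map φ) dvd_rfl) =
      (RingHom.ker φ).map (algebraMap O (AdjoinRoot f)) := by
  refine le_antisymm (fun a ha ↦ ?_) (Ideal.map_le_iff_le_comap.mpr fun a ha ↦ ?_)
  · obtain ⟨P, rfl⟩ := mk_surjective a
    rw [RingHom.mem_ker, map_mk, mk_eq_zero] at ha
    obtain ⟨Q, hQ⟩ := ha
    obtain ⟨Q, rfl⟩ := Polynomial.map_surjective φ hφ Q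
    have h : P - f * Q ∈ (RingHom.ker φ).map C := by
      rw [← Polynomial.ker_mapRingHom, RingHom.mem_ker, coe_mapRingHom, Polynomial.map_sub, hQ,
        Polynomial.map_mul, sub_self]
    have h2 := Ideal.mem_map_of_mem (mk f) h
    rwa [Ideal.map_map, map_sub, map_mul, mk_self, zero_mul, sub_zero] at h2
  · rw [RingHom.mem_ker] at ha
    rw [Ideal.mem_comap, RingHom.mem_ker, algebraMap_eq, ← mk_C, map_mk, map_C, ha, C_0, map_zero]

end AdjoinRoot

theorem Polynomial.irreducible_map_of_henselianRing {O k : Type*} [CommRing O] [Field k]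
    {φ : O →+* k} {f : O[X]}
    (hφ : Function.Surjective φ) [IsDomain (AdjoinRoot f)]
    [HenselianRing (AdjoinRoot f) (RingHom.ker (AdjoinRoot.map φ f (f.map φ) dvd_rfl))]
    (hf : (f.map φ).Separable) (hf1 : ¬ IsUnit (f.map φ)) : Irreducible (f.map φ) := by
  refine ⟨hf1, fun {g h} hgh ↦ ?_⟩
  obtain ⟨a, b, hab⟩ := (hgh ▸ hf : (g * h).Separable).isCoprime
  set e := AdjoinRoot.mk (f.map φ) (a * g) with he
  have he2 : e * e = e := by
    rw [he, ← map_mul, AdjoinRoot.mk_eq_mk, hgh]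
    exact ⟨-(a * b), by linear_combination (a * g) * hab⟩
  obtain ⟨E, hE, hEe⟩ := HenselianRing.exists_isRoot _ (AdjoinRoot.map_surjective φ hφ f)
    (q := X ^ 2 - X) (monic_X_pow_sub (by simp)) (s := e)
    (by simp [eval₂_sub, pow_two, he2]) (.of_mul_eq_one (2 * e - 1) (by
      simp [eval₂_sub]
      linear_combination 4 * he2))
  have hE' : E * (E - 1) = 0 := by
    rw [IsRoot.def] at hE
    simp at hE
    linear_combination hE
  have key : ∀ {g h a b : k[X]}, f.map φ = g * h → a * g + b * h = 1 →
      AdjoinRoot.mk (f.map φ) (a * g) = 0 → IsUnit h := fun {g h a b} hgh hab h0 ↦ by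
    rw [AdjoinRoot.mk_eq_zero, hgh, mul_comm] at h0
    have hg : g ≠ 0 := fun h ↦ hf.ne_zero (by rw [hgh, h, zero_mul])
    refine isUnit_of_dvd_one (hab ▸ dvd_add (Dvd.dvd.mul_right ?_ _) (dvd_mul_left _ _))
    exact (mul_dvd_mul_iff_right hg).mp h0
  rcases mul_eq_zero.mp hE' with h0 | h0
  · refine .inr (key hgh hab ?_)
    rw [← he, ← hEe, h0, map_zero]
  · refine .inl (key (hgh.trans (mul_comm _ _)) ((add_comm _ _).trans hab) ?_)
    rw [eq_sub_iff_add_eq'.mpr hab, map_sub, map_one, ← he, ← hEe, sub_eq_zero.mp h0, map_one,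
      sub_self]

theorem AdjoinRoot.exists_pow_eq_mk_of_finite {k : Type*} [Field k] [Finite k] {f : k[X]}
    (hirr : Irreducible f) (hf : f.Monic) (hf2 : 2 ≤ f.natDegree) {p : ℕ} (hp : p.Prime)
    (hm : ∀ q : ℕ, q.Prime → q ∣ f.natDegree → p ≤ q) (y : k) :
    ∃ δ : AdjoinRoot f, IsUnit δ ∧
      δ ^ p = mk f ((1 - C y * X) ^ f.natDegree * C (f.reverse.eval y ^ (p - 1))) := by
  have : Fact (Irreducible f) := ⟨hirr⟩
  have := hf.finite_adjoinRoot
  have : Finite (AdjoinRoot f) := Module.finite_of_finite k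
  have hrank : Module.finrank k (AdjoinRoot f) = f.natDegree := by
    rw [(AdjoinRoot.powerBasis' hf).finrank, AdjoinRoot.powerBasis'_dim]
  have hu : 1 - algebraMap k (AdjoinRoot f) y * root f ≠ 0 := by
    have h1 : (1 - C y * X).natDegree < f.natDegree := by
      refine lt_of_le_of_lt ?_ hf2
      compute_degree
    intro h
    have h2 : mk f (1 - C y * X) = 0 := by
      simpa [algebraMap_eq] using h
    simpa using congr_arg (eval 0) (eq_zero_of_dvd_of_natDegree_lt (mk_eq_zero.mp h2) h1)
  obtain ⟨δ, hδ⟩ := FiniteField.exists_pow_eq_pow_mul_norm_pow hp (by rwa [hrank])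
    (1 - algebraMap k (AdjoinRoot f) y * root f)
  refine ⟨δ, isUnit_iff_ne_zero.mpr ?_, ?_⟩
  · rintro rfl
    rw [zero_pow hp.ne_zero] at hδ
    refine mul_ne_zero (pow_ne_zero _ hu) (pow_ne_zero _ ?_) hδ.symm
    rwa [Ne, FaithfulSMul.algebraMap_eq_zero_iff, ← Ne, Algebra.norm_ne_zero_iff]
  · rw [norm_one_sub_mul_root hf, hrank] at hδ
    simp [hδ, algebraMap_eq]

section

open IsLocalRing

variable {O : Type*} [CommRing O] [IsDomain O] [IsDiscreteValuationRing O]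
  [IsAdicComplete (maximalIdeal O) O]

theorem Polynomial.exists_dvd_pow_sub_of_residue_pow_eq [Finite (ResidueField O)] {f g : O[X]}
    (hf : f.Monic) {p : ℕ} (hp0 : p ≠ 0)
    (hp : (p : O) ∉ maximalIdeal O) {δ : AdjoinRoot (f.map (residue O))} (hδ : IsUnit δ)
    (hδp : δ ^ p = AdjoinRoot.mk _ (g.map (residue O))) :
    ∃ P : O[X], f ∣ P ^ p - g := by
  have := hf.finite_adjoinRoot
  have : HenselianRing (AdjoinRoot f) (RingHom.ker (AdjoinRoot.map (residue O) f _ dvd_rfl)) := by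
    rw [AdjoinRoot.ker_map _ residue_surjective, ker_residue]
    exact HenselianRing.of_finite_algebra
  obtain ⟨γ, hγ, -⟩ := HenselianRing.exists_isRoot _
    (AdjoinRoot.map_surjective (residue O) residue_surjective f)
    (q := X ^ p - C (AdjoinRoot.mk f g)) (monic_X_pow_sub_C _ hp0) (s := δ) (by
      simp [eval₂_sub, hδp, AdjoinRoot.map_mk]) (by
      have : IsUnit (residue O p) := by
        rw [isUnit_iff_ne_zero]
        rwa [Ne, residue_eq_zero_iff]
      have := this.map (algebraMap _ (AdjoinRoot (f.map (residue O))))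
      simp only [map_natCast] at this
      simpa [-IsUnit.mul_iff, derivative_X_pow] using this.mul (hδ.pow (p - 1)))
  obtain ⟨P, rfl⟩ := AdjoinRoot.mk_surjective γ
  refine ⟨P, ?_⟩
  rw [← AdjoinRoot.mk_eq_mk, map_pow]
  simpa [sub_eq_zero] using hγ

theorem Polynomial.exists_dvd_pow_sub [Finite (ResidueField O)] {f : O[X]} (hf : f.Monic)
    (hf2 : 2 ≤ f.natDegree) (hirr : Irreducible f) {p : ℕ} (hp : p.Prime)
    (hm : ∀ q : ℕ, q.Prime → q ∣ f.natDegree → p ≤ q) (hpO : (p : O) ∉ maximalIdeal O) {y : O}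
    (h : y ∈ maximalIdeal O ∨ (f.map (residue O)).Separable) :
    ∃ P : O[X], f ∣ P ^ p - (1 - C y * X) ^ f.natDegree * C (f.reverse.eval y ^ (p - 1)) := by
  have hfk : (f.map (residue O)).Monic := hf.map _
  have hrev : residue O (f.reverse.eval y) = (f.map (residue O)).reverse.eval (residue O y) := by
    rw [reverse, reverse, hf.natDegree_map, reflect_map, eval_map, eval₂_at_apply]
  rcases h with hy | hsep
  · refine exists_dvd_pow_sub_of_residue_pow_eq hf hp.ne_zero hpO isUnit_one ?_
    rw [← residue_eq_zero_iff] at hy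
    rw [hy, ← coeff_zero_eq_eval_zero, coeff_zero_reverse, hfk] at hrev
    simp [hrev, hy]
  have : IsDomain (AdjoinRoot f) := AdjoinRoot.isDomain_of_prime hirr.prime
  have := hf.finite_adjoinRoot
  have : HenselianRing (AdjoinRoot f) (RingHom.ker (AdjoinRoot.map (residue O) f _ dvd_rfl)) := by
    rw [AdjoinRoot.ker_map _ residue_surjective, ker_residue]
    exact HenselianRing.of_finite_algebra
  have hirrk := irreducible_map_of_henselianRing residue_surjective hsep (fun hu ↦ by
    rw [hfk.isUnit_iff] at hu
    rw [← hf.natDegree_map (residue O), hu, natDegree_one] at hf2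
    omega)
  obtain ⟨δ, hδ0, hδ⟩ := AdjoinRoot.exists_pow_eq_mk_of_finite hirrk hfk
    (hf2.trans_eq (hf.natDegree_map _).symm) hp (by rwa [hf.natDegree_map]) (residue O y)
  refine exists_dvd_pow_sub_of_residue_pow_eq hf hp.ne_zero hpO hδ0 (hδ.trans ?_)
  simp [hrev, hf.natDegree_map]

end

open IntermediateField in
theorem Polynomial.irreducible_and_not_dvd_of_finrank_eq {F L : Type*} [Field F] [Field L]
    [Algebra F L] {θ δ : L} (htop : F⟮θ, δ⟯ = ⊤) {f g : F[X]} (hf : f.Monic)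
    (hθ : aeval θ f = 0) {p : ℕ} (hp : p.Prime) (hδ : δ ^ p = aeval θ g)
    (hf0 : f.natDegree ≠ 0) (hrank : Module.finrank F L = f.natDegree * p) :
    Irreducible f ∧ ∀ P : F[X], ¬ f ∣ P ^ p - g := by
  have hθi : IsIntegral F θ := ⟨f, hf, hθ⟩
  have : FiniteDimensional F L := Module.finite_of_finrank_pos (by
    rw [hrank]; exact mul_pos (Nat.pos_of_ne_zero hf0) hp.pos)
  set α : F⟮θ⟯ := aeval (AdjoinSimple.gen F θ) g with hα
  have hαL : algebraMap F⟮θ⟯ L α = aeval θ g := by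
    rw [hα, ← aeval_algebraMap_apply, AdjoinSimple.algebraMap_gen]
  have hδi : IsIntegral F⟮θ⟯ δ := .of_finite _ _
  have htop2 : F⟮θ⟯⟮δ⟯ = ⊤ := by
    rw [← restrictScalars_eq_top_iff (K := F), adjoin_simple_adjoin_simple, htop]
  have h1 : Module.finrank F F⟮θ⟯ = (minpoly F θ).natDegree := adjoin.finrank hθi
  have h2 : Module.finrank F⟮θ⟯ L = (minpoly F⟮θ⟯ δ).natDegree := by
    rw [← adjoin.finrank hδi, htop2, finrank_top']
  have h3 := Module.finrank_mul_finrank F F⟮θ⟯ L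
  have hd1 : minpoly F θ ∣ f := minpoly.dvd F θ hθ
  have hq0 : (X ^ p - C α).Monic := monic_X_pow_sub_C α hp.ne_zero
  have hd2 : minpoly F⟮θ⟯ δ ∣ X ^ p - C α := minpoly.dvd _ _ (by simp [hδ, hαL])
  have hl1 := natDegree_le_of_dvd hd1 hf.ne_zero
  have hl2 := natDegree_le_of_dvd hd2 hq0.ne_zero
  rw [natDegree_X_pow_sub_C] at hl2
  rw [hrank, h1, h2] at h3
  have he1 : f.natDegree ≤ (minpoly F θ).natDegree := by
    by_contra! h
    exact (Nat.mul_lt_mul_of_lt_of_le h hl2 hp.pos).ne h3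
  have he2 : p ≤ (minpoly F⟮θ⟯ δ).natDegree := by
    by_contra! h
    exact (Nat.mul_lt_mul_of_le_of_lt hl1 h (Nat.pos_of_ne_zero hf0)).ne h3
  have hfe := eq_of_monic_of_dvd_of_natDegree_le (minpoly.monic hθi) hf hd1 he1
  have hqe := eq_of_monic_of_dvd_of_natDegree_le (minpoly.monic hδi) hq0 hd2
    (by rwa [natDegree_X_pow_sub_C])
  refine ⟨hfe ▸ minpoly.irreducible hθi, fun P hP ↦ ?_⟩
  refine X_pow_sub_C_irreducible_iff_of_prime hp |>.mp (hqe ▸ minpoly.irreducible hδi)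
    (aeval (AdjoinSimple.gen F θ) P) ?_
  obtain ⟨Q, hQ⟩ := hP
  have h4 := congr_arg (aeval (AdjoinSimple.gen F θ)) hQ
  have h5 : aeval (AdjoinSimple.gen F θ) f = 0 := by
    rw [hfe]; exact aeval_gen_minpoly F θ
  rwa [map_mul, h5, zero_mul, map_sub, map_pow, sub_eq_zero] at h4

open IntermediateField in
theorem AdjoinRoot.adjoin_root_root_eq_top {F : Type*} [Field F] {f : F[X]} [Fact (Irreducible f)]
    {q : (AdjoinRoot f)[X]} [Fact (Irreducible q)] :
    F⟮algebraMap (AdjoinRoot f) (AdjoinRoot q) (root f), root q⟯ = ⊤ := by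
  set S := F⟮algebraMap (AdjoinRoot f) (AdjoinRoot q) (root f), root q⟯
  have h1 : algebraMap (AdjoinRoot f) (AdjoinRoot q) (root f) ∈ S := subset_adjoin _ _ (by simp)
  have h2 : root q ∈ S := subset_adjoin _ _ (by simp)
  have h3 (a : AdjoinRoot f) : algebraMap (AdjoinRoot f) (AdjoinRoot q) a ∈ S := by
    obtain ⟨P, rfl⟩ := mk_surjective a
    rw [← aeval_eq, ← aeval_algebraMap_apply]
    exact algebra_adjoin_le_adjoin F _
      (Algebra.adjoin_mono (by simp) (aeval_mem_adjoin_singleton F _))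
  refine eq_top_iff.mpr fun a _ ↦ ?_
  obtain ⟨P, rfl⟩ := mk_surjective a
  rw [← aeval_eq, aeval_eq_sum_range]
  refine sum_mem fun i _ ↦ ?_
  rw [Algebra.smul_def]
  exact mul_mem (h3 _) (pow_mem h2 _)

open IntermediateField in
theorem Polynomial.exists_irreducible_natDegree_mul {F : Type*} [Field F] [CharZero F] {f g : F[X]}
    (hf : f.Monic) (hirr : Irreducible f) {p : ℕ} (hp : p.Prime)
    (hg : ∀ P : F[X], ¬ f ∣ P ^ p - g) :
    ∃ h : F[X], h.natDegree = f.natDegree * p ∧ Irreducible h ∧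
      ∀ (F' : Type*) [Field F'] [Algebra F F'], Irreducible (h.map (algebraMap F F')) →
        Irreducible (f.map (algebraMap F F')) ∧
          ∀ P : F'[X], ¬ f.map (algebraMap F F') ∣ P ^ p - g.map (algebraMap F F') := by
  have : Fact (Irreducible f) := ⟨hirr⟩
  have := hf.finite_adjoinRoot
  set q : (AdjoinRoot f)[X] := X ^ p - C (AdjoinRoot.mk f g) with hq
  have hqm : q.Monic := monic_X_pow_sub_C _ hp.ne_zero
  have : Fact (Irreducible q) := ⟨X_pow_sub_C_irreducible_of_prime hp fun b hb ↦ by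
    obtain ⟨P, rfl⟩ := AdjoinRoot.mk_surjective b
    rw [← map_pow, AdjoinRoot.mk_eq_mk] at hb
    exact hg P hb⟩
  have := hqm.finite_adjoinRoot
  have : FiniteDimensional F (AdjoinRoot q) := .trans F (AdjoinRoot f) _
  have : Algebra.IsSeparable F (AdjoinRoot q) := inferInstance
  have hrank : Module.finrank F (AdjoinRoot q) = f.natDegree * p := by
    rw [← Module.finrank_mul_finrank F (AdjoinRoot f), (AdjoinRoot.powerBasis' hf).finrank,
      (AdjoinRoot.powerBasis' hqm).finrank, AdjoinRoot.powerBasis'_dim, AdjoinRoot.powerBasis'_dim,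
      hq, natDegree_X_pow_sub_C]
  set pb := Field.powerBasisOfFiniteOfSeparable F (AdjoinRoot q)
  refine ⟨minpoly F pb.gen, by rw [pb.natDegree_minpoly, ← pb.finrank, hrank],
    minpoly.irreducible pb.isIntegral_gen, fun F' _ _ hh ↦ ?_⟩
  have hhm := (minpoly.monic pb.isIntegral_gen).map (algebraMap F F')
  have : Fact (Irreducible ((minpoly F pb.gen).map (algebraMap F F'))) := ⟨hh⟩
  set L := AdjoinRoot ((minpoly F pb.gen).map (algebraMap F F'))
  set φ : AdjoinRoot q →ₐ[F] L := pb.lift (AdjoinRoot.root _) (by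
    rw [← aeval_map_algebraMap F', AdjoinRoot.aeval_eq, AdjoinRoot.mk_self])
  have hφ : φ pb.gen = AdjoinRoot.root _ := pb.lift_gen _ _
  set θ := algebraMap (AdjoinRoot f) (AdjoinRoot q) (AdjoinRoot.root f) with hθ
  have hθ0 (P : F[X]) : aeval θ P = algebraMap _ _ (AdjoinRoot.mk f P) := by
    rw [hθ, aeval_algebraMap_apply, AdjoinRoot.aeval_eq]
  have hθ' (P : F[X]) : aeval (φ θ) (P.map (algebraMap F F')) = φ (aeval θ P) := by
    rw [aeval_map_algebraMap, aeval_algHom_apply]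
  have hδ : AdjoinRoot.root q ^ p = aeval θ g := by
    have h : AdjoinRoot.mk q (X ^ p - C (AdjoinRoot.mk f g)) = 0 := AdjoinRoot.mk_self
    rwa [map_sub, map_pow, AdjoinRoot.mk_X, AdjoinRoot.mk_C, sub_eq_zero,
      ← AdjoinRoot.algebraMap_eq, ← hθ0] at h
  rw [← hf.natDegree_map (algebraMap F F')] at hrank
  refine irreducible_and_not_dvd_of_finrank_eq (L := L) (θ := φ θ) (δ := φ (AdjoinRoot.root q)) ?_
    (hf.map _) ?_ hp ?_ ?_ ?_
  · have h1 : (⊤ : IntermediateField F (AdjoinRoot q)) ≤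
        (F'⟮φ θ, φ (AdjoinRoot.root q)⟯.restrictScalars F).comap φ := by
      rw [← AdjoinRoot.adjoin_root_root_eq_top, adjoin_le_iff]
      rintro x (rfl | rfl)
      · exact subset_adjoin _ _ (by simp [hθ])
      · exact subset_adjoin _ _ (by simp)
    have h2 : φ pb.gen ∈ F'⟮φ θ, φ (AdjoinRoot.root q)⟯ := h1 trivial
    rw [hφ] at h2
    refine eq_top_iff.mpr fun a _ ↦ ?_
    obtain ⟨P, rfl⟩ := AdjoinRoot.mk_surjective a
    rw [← AdjoinRoot.aeval_eq]
    exact (IntermediateField.adjoin_simple_le_iff.mpr h2)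
      (algebra_adjoin_le_adjoin F' _ (aeval_mem_adjoin_singleton F' _))
  · rw [hθ', hθ0, AdjoinRoot.mk_self, map_zero, map_zero]
  · rw [hθ', ← hδ, map_pow]
  · rw [hf.natDegree_map]
    exact hirr.natDegree_pos.ne'
  · rw [← hrank, pb.finrank, ← pb.natDegree_minpoly, (AdjoinRoot.powerBasis' hhm).finrank,
      AdjoinRoot.powerBasis'_dim, (minpoly.monic pb.isIntegral_gen).natDegree_map]

section

variable {R : Type*} [CommRing R] [IsDedekindDomain R]

theorem IsDedekindDomain.HeightOneSpectrum.exists_forall_sub_mem_sq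
    {T : Set (HeightOneSpectrum R)} (hT : T.Finite) (x : HeightOneSpectrum R → R) :
    ∃ y, ∀ v ∈ T, y - x v ∈ v.asIdeal ^ 2 := by
  obtain ⟨y, hy⟩ := IsDedekindDomain.exists_forall_sub_mem_ideal (s := hT.toFinset)
    HeightOneSpectrum.asIdeal (fun _ ↦ 2) (fun v _ ↦ v.prime)
    (fun v _ w _ hvw h ↦ hvw (HeightOneSpectrum.ext h)) (fun v ↦ x v)
  exact ⟨y, fun v hv ↦ hy v (hT.mem_toFinset.mpr hv)⟩

theorem IsDedekindDomain.HeightOneSpectrum.finite_setOf_mem {r : R} (hr : r ≠ 0) :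
    {v : HeightOneSpectrum R | r ∈ v.asIdeal}.Finite := by
  have := Ideal.finite_factors (I := Ideal.span {r}) (by simpa using hr)
  simpa only [Ideal.dvd_span_singleton] using this

theorem Polynomial.exists_map_eq_C_mul (K : Type*) [Field K] [Algebra R K] [IsFractionRing R K]
    (a : K[X]) : ∃ d : R, d ≠ 0 ∧ ∃ A : R[X],
      A.map (algebraMap R K) = C (algebraMap R K d) * a := by
  obtain ⟨d, hd, h⟩ := IsLocalization.integerNormalization_spec (nonZeroDivisors R) a
  exact ⟨d, nonZeroDivisors.ne_zero hd, _, by rw [h, ← smul_eq_C_mul, algebraMap_smul]⟩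

theorem Polynomial.Monic.exists_mul_add_mul_derivative_eq_C (K : Type*) [Field K] [CharZero K]
    [Algebra R K] [IsFractionRing R K] {f : R[X]} (hf : f.Monic) (hirr : Irreducible f) :
    ∃ d : R, d ≠ 0 ∧ ∃ a b : R[X], a * f + b * derivative f = C d := by
  have hinj := IsFractionRing.injective R K
  obtain ⟨a, b, hab⟩ :=
    ((hf.irreducible_iff_irreducible_map_fraction_map (K := K)).mp hirr).separable
  obtain ⟨d, hd, A, hA⟩ := exists_map_eq_C_mul (R := R) K a
  obtain ⟨e, he, B, hB⟩ := exists_map_eq_C_mul (R := R) K b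
  refine ⟨d * e, mul_ne_zero hd he, C e * A, C d * B, map_injective _ hinj ?_⟩
  simp only [Polynomial.map_add, Polynomial.map_mul, hA, hB, ← derivative_map, map_C, map_mul]
  linear_combination (C (algebraMap R K d) * C (algebraMap R K e)) * hab

theorem Polynomial.exists_monic_irreducible_dichotomy (K : Type*) [Field K] [CharZero K]
    [Algebra R K] [IsFractionRing R K] {v₀ v₁ : HeightOneSpectrum R} (h01 : v₀ ≠ v₁) {r : R}
    (hr0 : r ≠ 0) (hr : r ∉ v₁.asIdeal) {m : ℕ} (hm : 2 ≤ m) :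
    ∃ f : R[X], f.Monic ∧ f.natDegree = m ∧ Irreducible f ∧ ∃ y : R,
      (f.coeff 0 ∈ v₀.asIdeal ∧ f.coeff 1 ∉ v₀.asIdeal) ∧
      f.reverse.eval y ∈ v₀.asIdeal ∧ f.reverse.eval y ∉ v₀.asIdeal ^ 2 ∧
      ∀ v : HeightOneSpectrum R, (f.coeff 0 ∈ v.asIdeal ∧ f.coeff 1 ∉ v.asIdeal) ∨
        (r ∉ v.asIdeal ∧ (y ∈ v.asIdeal ∨
          ∃ d ∉ v.asIdeal, ∃ a b : R[X], a * f + b * derivative f = C d)) := by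
  classical
  have huni (v : HeightOneSpectrum R) : ∃ π ∈ v.asIdeal, π ∉ v.asIdeal ^ 2 := by
    simpa using Ideal.exists_mem_pow_notMem_pow_succ v.asIdeal v.ne_bot v.isPrime.ne_top 1
  have hsq (v : HeightOneSpectrum R) {x : R} (hx : x ∈ v.asIdeal ^ 2) : x ∈ v.asIdeal :=
    Ideal.pow_le_self two_ne_zero hx
  obtain ⟨π₀, hπ₀, hπ₀'⟩ := huni v₀
  obtain ⟨π₁, hπ₁, hπ₁'⟩ := huni v₁
  have hT : (insert v₀ (insert v₁ {v : HeightOneSpectrum R | r ∈ v.asIdeal})).Finite :=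
    ((finite_setOf_mem hr0).insert _).insert _
  obtain ⟨t, ht⟩ := exists_forall_sub_mem_sq hT fun v ↦ if v = v₁ then π₁ else 0
  obtain ⟨s, hs⟩ := exists_forall_sub_mem_sq hT
    fun v ↦ if v = v₁ then 0 else if v = v₀ then 1 - π₀ else 1
  have ht0 : t ∈ v₀.asIdeal ^ 2 := by simpa [h01] using ht v₀ (by simp)
  have ht1 : t - π₁ ∈ v₁.asIdeal ^ 2 := by simpa using ht v₁ (by simp)
  have hs0 : s - (1 - π₀) ∈ v₀.asIdeal ^ 2 := by simpa [h01] using hs v₀ (by simp)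
  have hs1 : s ∈ v₁.asIdeal ^ 2 := by simpa using hs v₁ (by simp)
  have hone (v : HeightOneSpectrum R) : (1 : R) ∉ v.asIdeal :=
    (Ideal.ne_top_iff_one _).mp v.isPrime.ne_top
  have hs0' : s ∉ v₀.asIdeal := fun h ↦ hone v₀ (by
    have := sub_mem h (hsq v₀ hs0)
    rw [sub_sub_cancel] at this
    simpa using add_mem this hπ₀)
  have htr (v : HeightOneSpectrum R) (hv : r ∈ v.asIdeal) : t ∈ v.asIdeal ∧ s ∉ v.asIdeal := by
    have hv1 : v ≠ v₁ := by rintro rfl; exact hr hv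
    by_cases hv0 : v = v₀
    · exact hv0 ▸ ⟨hsq _ ht0, hs0'⟩
    · have h1 := ht v (by simp [hv])
      have h2 := hs v (by simp [hv])
      simp only [hv1, hv0, if_false, sub_zero] at h1 h2
      exact ⟨hsq _ h1, fun h ↦ hone v (by simpa using sub_mem h (hsq _ h2))⟩
  set f : R[X] := X ^ m - C s * X + C t with hf
  have hf' : f = X ^ m + (C (-s) * X + C t) := by rw [hf, C_neg]; ring
  have hlow : (C (-s) * X + C t).degree < (m : WithBot ℕ) :=
    degree_linear_le.trans_lt (by exact_mod_cast hm)
  have hfm : f.Monic := hf' ▸ monic_X_pow_add hlow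
  have hfd : f.natDegree = m := natDegree_eq_of_degree_eq_some (by
    rw [hf', degree_add_eq_left_of_degree_lt (by rwa [degree_X_pow]), degree_X_pow])
  have hf0 : f.coeff 0 = t := by simp [hf, show 0 ≠ m by omega]
  have hf1 : f.coeff 1 = -s := by
    simp [hf, coeff_X_pow, show 1 ≠ m by omega, coeff_C_succ]
  have hfi (i : ℕ) (hi : i ≠ m) (hi0 : i ≠ 0) (hi1 : i ≠ 1) : f.coeff i = 0 := by
    simp [hf, coeff_X_pow, hi, coeff_C, hi0, coeff_X, hi1.symm]
  have hirr : Irreducible f := by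
    refine irreducible_of_eisenstein_criterion v₁.isPrime (by rw [hfm]; exact hone v₁)
      (fun i hi ↦ ?_) ?_ ?_ hfm.isPrimitive
    · have hi : i ≠ m := by
        rw [← hfd]
        rintro rfl
        exact hi.ne (degree_eq_natDegree hfm.ne_zero).symm
      by_cases hi0 : i = 0
      · rw [hi0, hf0]
        simpa using add_mem (hsq _ ht1) hπ₁
      by_cases hi1 : i = 1
      · rw [hi1, hf1, neg_mem_iff]
        exact hsq _ hs1
      · rw [hfi i hi hi0 hi1]
        exact zero_mem _
    · rw [← natDegree_pos_iff_degree_pos, hfd]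
      omega
    · rw [hf0]
      exact fun h ↦ hπ₁' (by simpa using sub_mem h ht1)
  have hrev (y : R) : f.reverse.eval y = 1 - s * y ^ (m - 1) + t * y ^ m := by
    rw [reverse, hfd, hf, reflect_add, reflect_sub, reflect_monomial, reflect_C,
      ← pow_one X, reflect_C_mul_X_pow, revAt_le (by omega), revAt_le (by omega)]
    simp
  obtain ⟨d, hd, a, b, hab⟩ := hfm.exists_mul_add_mul_derivative_eq_C K hirr
  obtain ⟨y, hy⟩ := exists_forall_sub_mem_sq ((finite_setOf_mem hd).insert v₀)
    fun v ↦ if v = v₀ then 1 else 0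
  have hy0 : y - 1 ∈ v₀.asIdeal ^ 2 := by simpa using hy v₀ (by simp)
  have hyd (v : HeightOneSpectrum R) (hv : d ∈ v.asIdeal) (hv0 : v ≠ v₀) : y ∈ v.asIdeal :=
    hsq _ (by simpa [hv0] using hy v (by simp [hv]))
  have hrev0 : f.reverse.eval y - π₀ ∈ v₀.asIdeal ^ 2 := by
    have h1 : y ^ (m - 1) - 1 ∈ v₀.asIdeal ^ 2 :=
      Ideal.mem_of_dvd _ (by simpa using sub_dvd_pow_sub_pow y 1 (m - 1)) hy0
    have h2 : f.reverse.eval y - π₀ =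
        t * y ^ m - (s * (y ^ (m - 1) - 1)) - (s - (1 - π₀)) := by rw [hrev]; ring
    rw [h2]
    exact sub_mem (sub_mem (Ideal.mul_mem_right _ _ ht0) (Ideal.mul_mem_left _ _ h1)) hs0
  refine ⟨f, hfm, hfd, hirr, y, ?_, ?_, fun h ↦ hπ₀' (by simpa using sub_mem h hrev0), fun v ↦ ?_⟩
  · rw [hf0, hf1, neg_mem_iff]
    exact ⟨hsq _ ht0, hs0'⟩
  · simpa using add_mem (hsq _ hrev0) hπ₀
  · rw [hf0, hf1, neg_mem_iff]
    by_cases hrv : r ∈ v.asIdeal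
    · exact .inl (htr v hrv)
    by_cases hv0 : v = v₀
    · exact .inl (hv0 ▸ ⟨hsq _ ht0, hs0'⟩)
    by_cases hdv : d ∈ v.asIdeal
    · exact .inr ⟨hrv, .inl (hyd v hdv hv0)⟩
    · exact .inr ⟨hrv, .inr ⟨d, hdv, a, b, hab⟩⟩

end

section

variable {R : Type*} [CommRing R] [IsDedekindDomain R] (K : Type*) [Field K] [Algebra R K]
  [IsFractionRing R K] (v : HeightOneSpectrum R)

open IsLocalRing

theorem Polynomial.Monic.exists_isRoot_adicCompletionIntegers {f : R[X]} (hf : f.Monic)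
    (h0 : f.coeff 0 ∈ v.asIdeal) (h1 : f.coeff 1 ∉ v.asIdeal) :
    ∃ r ∈ maximalIdeal (v.adicCompletionIntegers K),
      (f.map (algebraMap R (v.adicCompletionIntegers K))).IsRoot r := by
  have := adicCompletionIntegers_isAdicComplete K v
  have : HenselianRing (v.adicCompletionIntegers K)
      (RingHom.ker (residue (v.adicCompletionIntegers K))) := by
    rw [ker_residue]; infer_instance
  rw [← algebraMap_mem_maximalIdeal_iff K, ← residue_eq_zero_iff] at h0 h1
  obtain ⟨r, hr, hr0⟩ := HenselianRing.exists_isRoot (residue (v.adicCompletionIntegers K))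
    residue_surjective (hf.map (algebraMap R (v.adicCompletionIntegers K))) (s := 0)
    (by rw [← eval_map, ← coeff_zero_eq_eval_zero, coeff_map, coeff_map, h0])
    (by
      rw [isUnit_iff_ne_zero, ← eval_map, ← coeff_zero_eq_eval_zero, coeff_map, coeff_derivative,
        coeff_map]
      simpa using h1)
  exact ⟨r, (residue_eq_zero_iff r).mp hr0, hr⟩

theorem IsDedekindDomain.HeightOneSpectrum.log_valued_algebraMap {c : R} (hc : c ∈ v.asIdeal)
    (hc2 : c ∉ v.asIdeal ^ 2) :
    WithZero.log (Valued.v (algebraMap K (v.adicCompletion K) (algebraMap R K c))) = -1 := by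
  have h1 := (v.intValuation_le_pow_iff_mem c 1).mpr (by simpa using hc)
  have h2 := (v.intValuation_le_pow_iff_mem c 2).not.mpr hc2
  have h : Valued.v (algebraMap K (v.adicCompletion K) (algebraMap R K c)) = v.intValuation c :=
    (valuedAdicCompletion_eq_valuation v c).trans (valuation_of_algebraMap v c)
  have hc0 : v.intValuation c ≠ 0 := fun h ↦ h2 (h ▸ zero_le)
  rw [h]
  rw [← WithZero.exp_log hc0, WithZero.exp_le_exp] at h1 h2
  push_cast at h1 h2
  omega

theorem Polynomial.Monic.not_dvd_pow_sub {f : R[X]} (hf : f.Monic) (h0 : f.coeff 0 ∈ v.asIdeal)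
    (h1 : f.coeff 1 ∉ v.asIdeal) {c : R} (hc : c ∈ v.asIdeal) (hc2 : c ∉ v.asIdeal ^ 2)
    {p : ℕ} (hp : p.Prime) (y : R) (m : ℕ) (P : K[X]) :
    ¬ f.map (algebraMap R K) ∣
      P ^ p - ((1 - C y * X) ^ m * C (c ^ (p - 1))).map (algebraMap R K) := by
  rintro ⟨Q, hQ⟩
  obtain ⟨r, hr, hfr⟩ := hf.exists_isRoot_adicCompletionIntegers K v h0 h1
  set r' : v.adicCompletion K := algebraMap (v.adicCompletionIntegers K) _ r with hr'
  have hfr' : aeval r' f = 0 := by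
    rw [hr', aeval_algebraMap_apply, aeval_def, ← eval_map, hfr, map_zero]
  have h := congr_arg (aeval r') hQ
  rw [map_mul, aeval_map_algebraMap, hfr', zero_mul, map_sub, aeval_map_algebraMap,
    sub_eq_zero, map_pow, map_mul, map_pow, aeval_C] at h
  have hu : Valued.v (aeval r' (1 - C y * X)) = 1 := by
    set z : v.adicCompletionIntegers K :=
      1 - algebraMap R (v.adicCompletionIntegers K) y * r with hz
    have h2 : aeval r' (1 - C y * X) = (z : v.adicCompletion K) := by
      change _ = algebraMap (v.adicCompletionIntegers K) (v.adicCompletion K) z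
      rw [hr', aeval_algebraMap_apply]
      simp [hz]
    have hmem : z ∉ maximalIdeal (v.adicCompletionIntegers K) := fun h3 ↦
      (Ideal.ne_top_iff_one _).mp (maximalIdeal.isMaximal _).ne_top
        (by
          have := add_mem h3
            (Ideal.mul_mem_left _ (algebraMap R (v.adicCompletionIntegers K) y) hr)
          rwa [hz, sub_add_cancel] at this)
    rw [adicCompletionIntegers_mem_maximalIdeal_iff K v] at hmem
    rw [h2]
    exact le_antisymm z.2 (not_lt.mp hmem)
  have hlog := congr_arg (fun x ↦ WithZero.log (Valued.v x)) h
  simp only [map_pow, map_mul, hu, one_pow, one_mul, WithZero.log_pow,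
    IsScalarTower.algebraMap_apply R K (v.adicCompletion K),
    log_valued_algebraMap K v hc hc2] at hlog
  have h4 : (p : ℤ) ∣ 1 := by
    refine ⟨WithZero.log (Valued.v (aeval r' P)) + 1, ?_⟩
    have := hp.one_le
    simp only [nsmul_eq_mul] at hlog
    push_cast [this] at hlog
    linear_combination -hlog
  exact hp.one_lt.ne' (by exact_mod_cast Int.eq_one_of_dvd_one (by positivity) h4)

theorem Polynomial.Monic.reducible_or_exists_dvd_pow_sub [Finite (R ⧸ v.asIdeal)] {f : R[X]}
    (hf : f.Monic) (hf2 : 2 ≤ f.natDegree) {p : ℕ} (hp : p.Prime)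
    (hm : ∀ q : ℕ, q.Prime → q ∣ f.natDegree → p ≤ q) {y : R}
    (h : (f.coeff 0 ∈ v.asIdeal ∧ f.coeff 1 ∉ v.asIdeal) ∨
      ((p : R) ∉ v.asIdeal ∧ (y ∈ v.asIdeal ∨
        ∃ d ∉ v.asIdeal, ∃ a b : R[X], a * f + b * derivative f = C d)))
    (hirr : Irreducible (f.map (algebraMap R (v.adicCompletion K)))) :
    ∃ P : (v.adicCompletion K)[X], f.map (algebraMap R (v.adicCompletion K)) ∣
      P ^ p - ((1 - C y * X) ^ f.natDegree * C (f.reverse.eval y ^ (p - 1))).map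
        (algebraMap R (v.adicCompletion K)) := by
  have htower := IsScalarTower.algebraMap_eq R (v.adicCompletionIntegers K) (v.adicCompletion K)
  set ι := algebraMap R (v.adicCompletionIntegers K) with hι
  rcases h with ⟨h0, h1⟩ | ⟨hpv, h⟩
  · obtain ⟨r, -, hr⟩ := hf.exists_isRoot_adicCompletionIntegers K v h0 h1
    have hr' := hr.map (f := algebraMap (v.adicCompletionIntegers K) (v.adicCompletion K))
    rw [Polynomial.map_map, ← htower] at hr'
    have : (f.map (algebraMap R (v.adicCompletion K))).natDegree = 1 :=
      natDegree_eq_of_degree_eq_some (degree_eq_one_of_irreducible_of_root hirr hr')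
    rw [hf.natDegree_map] at this
    omega
  · have := adicCompletionIntegers_isAdicComplete K v
    have := finite_residueField_adicCompletionIntegers K v
    rw [htower, ← Polynomial.map_map] at hirr
    rw [htower, ← Polynomial.map_map, ← Polynomial.map_map]
    rw [← (hf.map ι).irreducible_iff_irreducible_map_fraction_map] at hirr
    have hfd := hf.natDegree_map ι
    obtain ⟨P, hP⟩ := exists_dvd_pow_sub (hf.map ι) (by rwa [hfd]) hirr hp (by rwa [hfd])
      (by rwa [← map_natCast ι, algebraMap_mem_maximalIdeal_iff]) (y := ι y) (by
        refine h.imp (algebraMap_mem_maximalIdeal_iff K v y).mpr ?_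
        rintro ⟨d, hd, a, b, hab⟩
        set φ := (residue (v.adicCompletionIntegers K)).comp ι with hφ
        have hd : φ d ≠ 0 := by
          rwa [hφ, RingHom.comp_apply, Ne, residue_eq_zero_iff, algebraMap_mem_maximalIdeal_iff]
        rw [Polynomial.map_map, separable_def']
        refine ⟨C (φ d)⁻¹ * a.map φ, C (φ d)⁻¹ * b.map φ, ?_⟩
        have := congr_arg (Polynomial.map φ) hab
        rw [Polynomial.map_add, Polynomial.map_mul, Polynomial.map_mul, map_C,
          ← derivative_map] at this
        rw [mul_assoc, mul_assoc, ← mul_add, this, ← C_mul, inv_mul_cancel₀ hd, C_1])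
    refine ⟨P.map (algebraMap _ _), ?_⟩
    have hP' := Polynomial.map_dvd (algebraMap (v.adicCompletionIntegers K) (v.adicCompletion K)) hP
    rw [Polynomial.map_sub, Polynomial.map_pow] at hP'
    convert! hP' using 3
    rw [hfd, reverse, reverse, hfd, reflect_map, eval_map, eval₂_at_apply]
    simp

end

theorem NumberField.exists_forall_natCast_mem_asIdeal_iff (F : Type*) [Field F] [NumberField F]
    {p : ℕ} (hp : p.Prime) : ∃ v : HeightOneSpectrum (NumberField.RingOfIntegers F),
      ∀ k : ℕ, (k : NumberField.RingOfIntegers F) ∈ v.asIdeal ↔ p ∣ k := by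
  have hmax : (Ideal.span {(p : ℤ)}).IsMaximal :=
    PrincipalIdealRing.isMaximal_of_irreducible (Nat.prime_iff_prime_int.mp hp).irreducible
  obtain ⟨Q, hQ, hQp⟩ := Ideal.exists_ideal_over_maximal_of_isIntegral
    (S := NumberField.RingOfIntegers F) (Ideal.span {(p : ℤ)}) (by
      rw [(RingHom.injective_iff_ker_eq_bot (algebraMap ℤ (NumberField.RingOfIntegers F))).mp
        (FaithfulSMul.algebraMap_injective _ _)]
      exact bot_le)
  have hk (k : ℕ) : (k : NumberField.RingOfIntegers F) ∈ Q ↔ p ∣ k := by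
    rw [← Int.natCast_dvd_natCast, ← Ideal.mem_span_singleton, ← hQp, Ideal.mem_comap, map_natCast]
  refine ⟨⟨Q, hQ.isPrime, ?_⟩, hk⟩
  rintro rfl
  simpa [hp.ne_zero] using (hk p).mpr dvd_rfl

end

/-- For a number field `F` and a composite positive integer `n`, there is `f ∈ F[x]` of
degree `n`, irreducible over `F`, which is reducible over the completion `F_v` for every
nonzero prime ideal `v` of `O_F`. -/
theorem stmt_16 (F : Type*) [Field F] [NumberField F]
    (n : ℕ) (hn : 1 < n) (hn' : ¬ n.Prime) :
    ∃ f : Polynomial F, f.natDegree = n ∧ Irreducible f ∧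
      ∀ v : IsDedekindDomain.HeightOneSpectrum (NumberField.RingOfIntegers F),
        ¬ Irreducible (f.map (algebraMap F (v.adicCompletion F))) := by
  have hp : n.minFac.Prime := Nat.minFac_prime hn.ne'
  obtain ⟨m, hm⟩ := n.minFac_dvd
  have hm2 : 2 ≤ m := by
    have h0 : m ≠ 0 := by rintro rfl; omega
    have h1 : m ≠ 1 := by
      rintro rfl
      exact hn' (Nat.prime_def_minFac.mpr ⟨hn, by omega⟩)
    omega
  have hmp : ∀ q : ℕ, q.Prime → q ∣ m → n.minFac ≤ q := fun q hq hqm ↦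
    Nat.minFac_le_of_dvd hq.two_le (hqm.trans ⟨n.minFac, by rwa [mul_comm]⟩)
  generalize n.minFac = p at hp hm hmp
  obtain ⟨l, hl, hlp⟩ := Nat.exists_infinite_primes (p + 1)
  obtain ⟨v₀, hv₀⟩ := NumberField.exists_forall_natCast_mem_asIdeal_iff F hp
  obtain ⟨v₁, hv₁⟩ := NumberField.exists_forall_natCast_mem_asIdeal_iff F hlp
  have hpv₁ : (p : NumberField.RingOfIntegers F) ∉ v₁.asIdeal := fun h ↦
    absurd (Nat.le_of_dvd hp.pos ((hv₁ p).mp h)) (by omega)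
  obtain ⟨f, hf, hfd, hirr, y, ⟨h0, h1⟩, hc, hc2, hv⟩ :=
    Polynomial.exists_monic_irreducible_dichotomy F (v₀ := v₀) (v₁ := v₁)
      (by rintro rfl; exact hpv₁ ((hv₀ p).mpr dvd_rfl)) (by exact_mod_cast hp.ne_zero) hpv₁ hm2
  obtain ⟨h, hhd, hhirr, hh⟩ := Polynomial.exists_irreducible_natDegree_mul
    (hf.map (algebraMap (NumberField.RingOfIntegers F) F))
    ((hf.irreducible_iff_irreducible_map_fraction_map (K := F)).mp hirr) hp
    (hf.not_dvd_pow_sub F v₀ h0 h1 hc hc2 hp y m)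
  refine ⟨h, by rw [hhd, hf.natDegree_map, hfd, hm, mul_comm], hhirr, fun v hvirr ↦ ?_⟩
  obtain ⟨hfv, hP⟩ := hh _ hvirr
  have := Ideal.finiteQuotientOfFreeOfNeBot v.asIdeal v.ne_bot
  simp only [Polynomial.map_map, ← IsScalarTower.algebraMap_eq] at hfv hP
  obtain ⟨P, hP'⟩ := hf.reducible_or_exists_dvd_pow_sub F v (hfd ▸ hm2) hp (hfd ▸ hmp) (hv v) hfv
  exact hP P (hfd ▸ hP')
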